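/- Let a, b, c, d be positive integers with a + c and b + d both even. Then at least one of the four cyclic rotations 1^a 0^b 1^c 0^d, 0^b 1^c 0^d 1^a, 1^c 0^d 1^a 0^b, 0^d 1^a 0^b 1^c is a shuffle square. -/

import Mathlib

/-- `Interleave x y z` means that `z` is an interleaving (shuffle) of the words
`x` and `y`. -/
inductive Interleave {α : Type*} : List α → List α → List α → Prop
  | nil : Interleave [] [] []
  | cons_left (a : α) {xs ys zs : List α} :
      Interleave xs ys zs → Interleave (a :: xs) ys (a :: zs)
  | cons_right (a : α) {xs ys zs : List α} :
      Interleave xs ys zs → Interleave xs (a :: ys) (a :: zs)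

/-- A word is a shuffle square if it is an interleaving of two copies of the same word. -/
def IsShuffleSquare {α : Type*} (w : List α) : Prop :=
  ∃ x : List α, Interleave x x w

theorem Interleave.append {α : Type*} {x y z x' y' z' : List α}
    (h : Interleave x y z) (h' : Interleave x' y' z') :
    Interleave (x ++ x') (y ++ y') (z ++ z') := by
  induction h with
  | nil => exact h'
  | cons_left a _ ih => exact .cons_left a ih
  | cons_right a _ ih => exact .cons_right a ih

theorem Interleave.left {α : Type*} (w : List α) : Interleave w [] w := by
  induction w with
  | nil => exact .nil
  | cons a _ ih => exact .cons_left a ih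

theorem Interleave.right {α : Type*} (w : List α) : Interleave [] w w := by
  induction w with
  | nil => exact .nil
  | cons a _ ih => exact .cons_right a ih

/-- A four-run word `u^p v^q u^r v^s` with `r ≤ p`, `q ≤ s` and both `p + r` and `q + s` even is
a shuffle square, with root `u^((p+r)/2) v^((q+s)/2)`. -/
theorem isShuffleSquare_four_runs {α : Type*} (u v : α) {p q r s : ℕ}
    (hrp : r ≤ p) (hqs : q ≤ s) (hpr : Even (p + r)) (hqs' : Even (q + s)) :
    IsShuffleSquare (List.replicate p u ++ List.replicate q v ++
      List.replicate r u ++ List.replicate s v) := by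
  obtain ⟨m, hm⟩ := hpr
  obtain ⟨n, hn⟩ := hqs'
  obtain ⟨k, rfl⟩ : ∃ k, p = r + k + k := ⟨m - r, by omega⟩
  obtain ⟨l, rfl⟩ : ∃ l, s = l + (q + l) := ⟨n - q, by omega⟩
  refine ⟨List.replicate (r + k) u ++ List.replicate (q + l) v, ?_⟩
  have h := (Interleave.left (List.replicate (r + k) u)).append <|
    (Interleave.right (List.replicate k u)).append <|
    (Interleave.left (List.replicate q v)).append <|
    (Interleave.right (List.replicate r u)).append <|
    (Interleave.left (List.replicate l v)).append <|
    Interleave.right (List.replicate (q + l) v)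
  convert h using 1
  · simp only [List.replicate_add, List.append_assoc, List.nil_append, List.append_nil]
  · rw [add_comm r k]
    simp only [List.replicate_add, List.append_assoc, List.nil_append]
  · simp only [List.replicate_add, List.append_assoc]

theorem statement11 (a b c d : ℕ) (ha : 0 < a) (hb : 0 < b) (hc : 0 < c) (hd : 0 < d)
    (hac : Even (a + c)) (hbd : Even (b + d)) :
    IsShuffleSquare
        (List.replicate a true ++ List.replicate b false ++
          List.replicate c true ++ List.replicate d false) ∨
    IsShuffleSquare
        (List.replicate b false ++ List.replicate c true ++
          List.replicate d false ++ List.replicate a true) ∨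
    IsShuffleSquare
        (List.replicate c true ++ List.replicate d false ++
          List.replicate a true ++ List.replicate b false) ∨
    IsShuffleSquare
        (List.replicate d false ++ List.replicate a true ++
          List.replicate b false ++ List.replicate c true) := by
  have hca : Even (c + a) := by rwa [add_comm]
  have hdb : Even (d + b) := by rwa [add_comm]
  rcases le_total c a with h | h <;> rcases le_total b d with h' | h'
  · exact .inl (isShuffleSquare_four_runs _ _ h h' hac hbd)
  · exact .inr (.inl (isShuffleSquare_four_runs _ _ h' h hbd hca))
  · exact .inr (.inr (.inr (isShuffleSquare_four_runs _ _ h' h hdb hac)))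
  · exact .inr (.inr (.inl (isShuffleSquare_four_runs _ _ h h' hca hdb)))
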